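/- arXiv:2507.05037 — 2 statements merged into one kernel-verified Lean document; each statement's English description precedes it below -/
import Mathlib

section
/- Let q ≥ 5 be a prime power and let 𝓑 be a minimal blocking set of PG(2,q) built with a k-construction with 2q ≤ k ≤ 3q−5. Then 𝓑 has the r∞-property with respect to every point P of 𝓑 lying on b or on c, and with respect to every point P of 𝓑 lying on a that does not lie on any of the lines B_iC_j (1 ≤ i, j ≤ n). -/
abbrev Pt (F : Type) [Field F] : Type :=
  {P : Submodule F (Fin 3 → F) // Module.finrank F ↥P = 1}

abbrev Ln (F : Type) [Field F] : Type :=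
  {L : Submodule F (Fin 3 → F) // Module.finrank F ↥L = 2}

variable {F : Type} [Field F]

def Incid (P : Pt F) (L : Ln F) : Prop := P.1 ≤ L.1

def IsTangent (K : Set (Pt F)) (L : Ln F) : Prop := ∃! P : Pt F, P ∈ K ∧ Incid P L

def IsSecant (K : Set (Pt F)) (L : Ln F) : Prop :=
  ∃ P Q : Pt F, P ≠ Q ∧ P ∈ K ∧ Q ∈ K ∧ Incid P L ∧ Incid Q L

def IsBlocking (B : Set (Pt F)) : Prop :=
  (∀ L : Ln F, ∃ P ∈ B, Incid P L) ∧ (∀ L : Ln F, ∃ P : Pt F, Incid P L ∧ P ∉ B)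

def IsMinimalBlocking (B : Set (Pt F)) : Prop :=
  IsBlocking B ∧ ∀ B' : Set (Pt F), B' ⊂ B → ¬ IsBlocking B'

def IsSemioval (K : Set (Pt F)) : Prop :=
  ∀ P ∈ K, ∃! L : Ln F, Incid P L ∧ IsTangent K L

def HasRInftyAt (B : Set (Pt F)) (P : Pt F) : Prop :=
  ∃ r : Ln F, Incid P r ∧ IsTangent B r ∧
    ∀ L : Ln F, Incid P L → L ≠ r → IsSecant B L

def NonConcurrent (a b c : Ln F) : Prop :=
  ¬ ∃ P : Pt F, Incid P a ∧ Incid P b ∧ Incid P c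

def VertexlessTriangle (a b c : Ln F) : Set (Pt F) :=
  {P | (Incid P a ∧ ¬ Incid P b ∧ ¬ Incid P c) ∨
       (¬ Incid P a ∧ Incid P b ∧ ¬ Incid P c) ∨
       (¬ Incid P a ∧ ¬ Incid P b ∧ Incid P c)}

def AffPts (l m : Ln F) : Set (Pt F) := {P | Incid P m ∧ ¬ Incid P l}

def IsAffBlocking (l : Ln F) (B : Set (Pt F)) : Prop :=
  (∀ P ∈ B, ¬ Incid P l) ∧ (∀ m : Ln F, m ≠ l → ∃ P ∈ B, Incid P m)

def IsMinimalAffBlocking (l : Ln F) (B : Set (Pt F)) : Prop :=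
  IsAffBlocking l B ∧ ∀ B' : Set (Pt F), B' ⊂ B → ¬ IsAffBlocking l B'

def PiProp (l : Ln F) (Pinf : Pt F) (B : Set (Pt F)) : Prop :=
  (∀ Q ∈ B, ∃ m : Ln F, m ≠ l ∧ ¬ Incid Pinf m ∧ Incid Q m ∧ IsTangent B m) ∧
  (∀ m : Ln F, m ≠ l → Incid Pinf m → ¬ (AffPts l m ⊆ B))

def PiStrong (l : Ln F) (Pinf : Pt F) (B : Set (Pt F)) : Prop :=
  (∀ Q ∈ B, ∃! m : Ln F, m ≠ l ∧ ¬ Incid Pinf m ∧ Incid Q m ∧ IsTangent B m) ∧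
  (∀ m : Ln F, m ≠ l → Incid Pinf m → ¬ (AffPts l m ⊆ B))

structure KConstruction (F : Type) [Field F] (n : ℕ) : Type where
  a : Ln F
  b : Ln F
  c : Ln F
  noncon : NonConcurrent a b c
  PA : Pt F
  PB : Pt F
  PC : Pt F
  hPA : Incid PA b ∧ Incid PA c
  hPB : Incid PB a ∧ Incid PB c
  hPC : Incid PC a ∧ Incid PC b
  el : Ln F
  hel : Incid PA el ∧ el ≠ b ∧ el ≠ c
  A' : Pt F
  hA' : Incid A' el ∧ Incid A' a
  D : Fin n → Pt F
  hD_inj : Function.Injective D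
  hD : ∀ i, Incid (D i) el ∧ ¬ Incid (D i) a ∧ ¬ Incid (D i) b ∧ ¬ Incid (D i) c
  Bp : Fin n → Pt F
  Cp : Fin n → Pt F
  hBp : ∀ i, Incid (Bp i) b ∧ ∃ m : Ln F, Incid PB m ∧ Incid (D i) m ∧ Incid (Bp i) m
  hCp : ∀ i, Incid (Cp i) c ∧ ∃ m : Ln F, Incid PC m ∧ Incid (D i) m ∧ Incid (Cp i) m

def KConstruction.pts {F : Type} [Field F] {n : ℕ} (K : KConstruction F n) : Set (Pt F) :=
  (VertexlessTriangle K.a K.b K.c ∪ Set.range K.D) \ (Set.range K.Bp ∪ Set.range K.Cp)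

theorem aux_line_unique {F : Type} [Field F] {P Q : Pt F} {L M : Ln F} (h : P ≠ Q)
    (h1 : Incid P L) (h2 : Incid Q L) (h3 : Incid P M) (h4 : Incid Q M) : L = M := by
  have hs := Submodule.finrank_sup_add_finrank_inf_eq P.1 Q.1
  rw [P.2, Q.2] at hs
  have hi : Module.finrank F ↥(P.1 ⊓ Q.1) ≤ 1 := by
    exact (Submodule.finrank_mono inf_le_left).trans P.2.le
  have hi0 : Module.finrank F ↥(P.1 ⊓ Q.1) ≠ 1 := by
    intro h1
    apply h
    apply Subtype.ext
    have e1 := Submodule.eq_of_le_of_finrank_eq (inf_le_left : P.1 ⊓ Q.1 ≤ P.1) (by rw [h1, P.2])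
    have e2 := Submodule.eq_of_le_of_finrank_eq (inf_le_right : P.1 ⊓ Q.1 ≤ Q.1) (by rw [h1, Q.2])
    exact e1.symm.trans e2
  have h2' : Module.finrank F ↥(P.1 ⊔ Q.1) = 2 := by omega
  have e1 := Submodule.eq_of_le_of_finrank_eq (sup_le h1 h2) (by rw [h2', L.2])
  have e2 := Submodule.eq_of_le_of_finrank_eq (sup_le h3 h4) (by rw [h2', M.2])
  exact Subtype.ext (e1.symm.trans e2)

theorem aux_pt_unique {F : Type} [Field F] {P Q : Pt F} {L M : Ln F} (h : L ≠ M)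
    (h1 : Incid P L) (h2 : Incid Q L) (h3 : Incid P M) (h4 : Incid Q M) : P = Q := by
  by_contra hne
  exact h (aux_line_unique hne h1 h2 h3 h4)

theorem aux_meet {F : Type} [Field F] (L M : Ln F) : ∃ P : Pt F, Incid P L ∧ Incid P M := by
  have hs := Submodule.finrank_sup_add_finrank_inf_eq L.1 M.1
  rw [L.2, M.2] at hs
  have h3 : Module.finrank F ↥(L.1 ⊔ M.1) ≤ 3 := by
    have := Submodule.finrank_le (L.1 ⊔ M.1)
    simpa using this
  have hpos : L.1 ⊓ M.1 ≠ ⊥ := by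
    intro h
    rw [h, finrank_bot] at hs
    omega
  obtain ⟨v, hv, hv0⟩ := Submodule.exists_mem_ne_zero_of_ne_bot hpos
  refine ⟨⟨Submodule.span F {v}, finrank_span_singleton hv0⟩, ?_, ?_⟩
  · exact (Submodule.span_singleton_le_iff_mem _ _).2 hv.1
  · exact (Submodule.span_singleton_le_iff_mem _ _).2 hv.2

theorem aux_count {F : Type} [Field F] [Fintype F] (A : Pt F) (L : Ln F) (hA : Incid A L)
    (S : Set (Pt F)) (hfin : S.Finite) (hS : S.ncard < Fintype.card F) :
    ∃ Q : Pt F, Incid Q L ∧ Q ≠ A ∧ Q ∉ S := by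
  have hAb : A.1 ≠ ⊥ := by
    intro h
    have := A.2
    rw [h, finrank_bot] at this
    omega
  obtain ⟨v, hv, hv0⟩ := Submodule.exists_mem_ne_zero_of_ne_bot hAb
  have hlt : A.1 < L.1 := by
    refine lt_of_le_of_ne hA ?_
    intro h
    have h1 := A.2
    have h2 := L.2
    rw [h] at h1
    omega
  obtain ⟨w, hw, hwA⟩ := SetLike.exists_of_lt hlt
  have hnz : ∀ t : F, w + t • v ∉ A.1 := by
    intro t ht
    apply hwA
    have := A.1.sub_mem ht (A.1.smul_mem t hv)
    simpa using this
  have hnz0 : ∀ t : F, w + t • v ≠ 0 := fun t h => hnz t (h ▸ A.1.zero_mem)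
  let f : F → Pt F := fun t => ⟨Submodule.span F {w + t • v}, finrank_span_singleton (hnz0 t)⟩
  have hmem : ∀ t, w + t • v ∈ (f t).1 := fun t => Submodule.mem_span_singleton_self _
  have hinj : Function.Injective f := by
    intro s t hst
    have h1 : w + s • v ∈ (f t).1 := hst ▸ hmem s
    obtain ⟨k, hk⟩ := Submodule.mem_span_singleton.1 h1
    have h2 : (1 - k) • w = (k * t - s) • v := by
      rw [smul_add, smul_smul] at hk
      rw [sub_smul, sub_smul, one_smul, sub_eq_sub_iff_add_eq_add, hk.symm]
      abel
    by_cases hk1 : 1 - k = 0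
    · rw [hk1, zero_smul] at h2
      have h3 := (smul_eq_zero.1 h2.symm).resolve_right hv0
      have : k = 1 := (sub_eq_zero.1 hk1).symm
      rw [this, one_mul] at h3
      exact (sub_eq_zero.1 h3).symm
    · exfalso
      apply hwA
      have : (1 - k) • w ∈ A.1 := h2 ▸ A.1.smul_mem _ hv
      exact (A.1.smul_mem_iff hk1).1 this
  have : ∃ t, f t ∉ S := by
    by_contra hcon
    push Not at hcon
    have hsub : Set.range f ⊆ S := by rintro _ ⟨t, rfl⟩; exact hcon t
    have h1 := Set.ncard_le_ncard hsub hfin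
    rw [← Set.image_univ, Set.ncard_image_of_injective _ hinj, Set.ncard_univ,
      Nat.card_eq_fintype_card] at h1
    omega
  obtain ⟨t, ht⟩ := this
  refine ⟨f t, ?_, ?_, ht⟩
  · exact (Submodule.span_singleton_le_iff_mem _ _).2 (L.1.add_mem hw (L.1.smul_mem t (hA hv)))
  · intro h
    exact hnz t (h ▸ hmem t)

theorem aux_finish {F : Type} [Field F] {B : Set (Pt F)} (hmin : IsMinimalBlocking B)
    {P X : Pt F} (hP : P ∈ B) (hX : P ≠ X)
    (h : ∀ L : Ln F, Incid P L → (∀ Q ∈ B, Incid Q L → Q = P) → Incid X L) :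
    HasRInftyAt B P := by
  have hb := hmin.1
  have hnb := hmin.2 (B \ {P}) (by
    refine ⟨Set.diff_subset, fun hc => ?_⟩
    exact (hc hP).2 rfl)
  have hex : ∃ r : Ln F, Incid P r ∧ ∀ Q ∈ B, Incid Q r → Q = P := by
    by_contra hcon
    apply hnb
    refine ⟨fun L => ?_, fun L => ?_⟩
    · by_contra hL
      have hall : ∀ Q ∈ B, Incid Q L → Q = P := by
        intro Q hQ hQL
        by_contra hne
        exact hL ⟨Q, ⟨hQ, hne⟩, hQL⟩
      obtain ⟨Q, hQ, hQL⟩ := hb.1 L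
      exact hcon ⟨L, hall Q hQ hQL ▸ hQL, hall⟩
    · obtain ⟨Q, hQ, hQB⟩ := hb.2 L
      exact ⟨Q, hQ, fun hc => hQB hc.1⟩
  obtain ⟨r, hPr, hr⟩ := hex
  refine ⟨r, hPr, ⟨P, ⟨hP, hPr⟩, fun Q hQ => hr Q hQ.1 hQ.2⟩, fun L hPL hne => ?_⟩
  by_contra hsec
  apply hne
  refine aux_line_unique hX hPL (h L hPL ?_) hPr (h r hPr hr)
  intro Q hQ hQL
  by_contra hQP
  exact hsec ⟨Q, P, hQP, hQ, hP, hQL, hPL⟩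

def KConstruction.swap {F : Type} [Field F] {n : ℕ} (K : KConstruction F n) :
    KConstruction F n where
  a := K.a
  b := K.c
  c := K.b
  noncon := fun ⟨P, h1, h2, h3⟩ => K.noncon ⟨P, h1, h3, h2⟩
  PA := K.PA
  PB := K.PC
  PC := K.PB
  hPA := ⟨K.hPA.2, K.hPA.1⟩
  hPB := K.hPC
  hPC := K.hPB
  el := K.el
  hel := ⟨K.hel.1, K.hel.2.2, K.hel.2.1⟩
  A' := K.A'
  hA' := K.hA'
  D := K.D
  hD_inj := K.hD_inj
  hD := fun i => ⟨(K.hD i).1, (K.hD i).2.1, (K.hD i).2.2.2, (K.hD i).2.2.1⟩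
  Bp := K.Cp
  Cp := K.Bp
  hBp := K.hCp
  hCp := K.hBp

theorem aux_swap_pts {F : Type} [Field F] {n : ℕ} (K : KConstruction F n) :
    K.swap.pts = K.pts := by
  ext P
  simp only [KConstruction.pts, KConstruction.swap, VertexlessTriangle, Set.mem_diff,
    Set.mem_union, Set.mem_setOf_eq]
  tauto

section
variable {F : Type} [Field F] {n : ℕ} (K : KConstruction F n)

theorem aux_ab : K.a ≠ K.b := fun h => K.noncon ⟨K.PB,
  K.hPB.1, h ▸ K.hPB.1, K.hPB.2⟩

theorem aux_ac : K.a ≠ K.c := fun h => K.noncon ⟨K.PC, K.hPC.1, K.hPC.2, h ▸ K.hPC.1⟩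

theorem aux_bc : K.b ≠ K.c := fun h => K.noncon ⟨K.PC, K.hPC.1, K.hPC.2, h ▸ K.hPC.2⟩

theorem aux_Bp_a (i : Fin n) : ¬ Incid (K.Bp i) K.a := by
  intro h
  obtain ⟨hb, m, h1, h2, h3⟩ := K.hBp i
  have hm : m = K.a := by
    refine aux_line_unique (P := K.PB) (Q := K.Bp i) ?_ h1 h3 K.hPB.1 h
    intro he
    exact K.noncon ⟨K.PB, K.hPB.1, he ▸ hb, K.hPB.2⟩
  exact (K.hD i).2.1 (hm ▸ h2)

theorem aux_Bp_c (i : Fin n) : ¬ Incid (K.Bp i) K.c := by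
  intro h
  obtain ⟨hb, m, h1, h2, h3⟩ := K.hBp i
  have hm : m = K.c := by
    refine aux_line_unique (P := K.PB) (Q := K.Bp i) ?_ h1 h3 K.hPB.2 h
    intro he
    exact K.noncon ⟨K.PB, K.hPB.1, he ▸ hb, K.hPB.2⟩
  exact (K.hD i).2.2.2 (hm ▸ h2)

theorem aux_Cp_a (i : Fin n) : ¬ Incid (K.Cp i) K.a := aux_Bp_a K.swap i

theorem aux_Cp_b (i : Fin n) : ¬ Incid (K.Cp i) K.b := aux_Bp_c K.swap i

theorem aux_mem_a {Q : Pt F} (h : Incid Q K.a) (h1 : ¬ Incid Q K.b) (h2 : ¬ Incid Q K.c) :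
    Q ∈ K.pts := by
  refine ⟨Or.inl (Or.inl ⟨h, h1, h2⟩), ?_⟩
  rintro (⟨i, rfl⟩ | ⟨i, rfl⟩)
  · exact aux_Bp_a K i h
  · exact aux_Cp_a K i h

theorem aux_mem_b {Q : Pt F} (h : Incid Q K.b) (h1 : ¬ Incid Q K.a) (h2 : ¬ Incid Q K.c)
    (h3 : Q ∉ Set.range K.Bp) : Q ∈ K.pts := by
  refine ⟨Or.inl (Or.inr (Or.inl ⟨h1, h, h2⟩)), ?_⟩
  rintro (h4 | ⟨i, rfl⟩)
  · exact h3 h4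
  · exact aux_Cp_b K i h

theorem aux_of_mem_b {P : Pt F} (hP : P ∈ K.pts) (h : Incid P K.b) :
    ¬ Incid P K.a ∧ ¬ Incid P K.c := by
  rcases hP.1 with (h1 | h1 | h1) | ⟨i, rfl⟩
  · exact absurd h h1.2.1
  · exact ⟨h1.1, h1.2.2⟩
  · exact absurd h h1.2.1
  · exact absurd h (K.hD i).2.2.1

theorem aux_of_mem_a {P : Pt F} (hP : P ∈ K.pts) (h : Incid P K.a) :
    ¬ Incid P K.b ∧ ¬ Incid P K.c := by
  rcases hP.1 with (h1 | h1 | h1) | ⟨i, rfl⟩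
  · exact h1.2
  · exact absurd h h1.1
  · exact absurd h h1.1
  · exact absurd h (K.hD i).2.1

theorem aux_b [Fintype F] (hq : 5 ≤ Fintype.card F) (hn2 : n ≤ Fintype.card F - 3)
    (hmin : IsMinimalBlocking K.pts) {P : Pt F} (hP : P ∈ K.pts) (hPb : Incid P K.b) :
    HasRInftyAt K.pts P := by
  obtain ⟨hPa, hPc⟩ := aux_of_mem_b K hP hPb
  refine aux_finish hmin hP (X := K.PB) (fun h => hPa (h ▸ K.hPB.1)) ?_
  intro L hPL htan
  by_contra hBL
  by_cases hL : L = K.b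
  · have hcard : (insert K.PC (insert P (Set.range K.Bp))).ncard < Fintype.card F := by
      have h1 := Set.ncard_insert_le K.PC (insert P (Set.range K.Bp))
      have h2 := Set.ncard_insert_le P (Set.range K.Bp)
      have h3 : (Set.range K.Bp).ncard ≤ n := by
        rw [← Set.image_univ]
        refine (Set.ncard_image_le Set.finite_univ).trans ?_
        simp [Set.ncard_univ]
      omega
    obtain ⟨Q, hQ, hQA, hQS⟩ := aux_count K.PA K.b K.hPA.1 _
      (((Set.finite_range K.Bp).insert _).insert _) hcard
    simp only [Set.mem_insert_iff, not_or] at hQS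
    refine hQS.2.1 (htan Q (aux_mem_b K hQ ?_ ?_ hQS.2.2) (hL ▸ hQ))
    · intro h
      exact hQS.1 (aux_pt_unique (aux_ab K) h K.hPC.1 hQ K.hPC.2)
    · intro h
      exact hQA (aux_pt_unique (aux_bc K) hQ K.hPA.1 h K.hPA.2)
  · obtain ⟨Q, hQL, hQa⟩ := aux_meet L K.a
    have hQP : Q ≠ P := fun h => hPa (h ▸ hQa)
    refine hQP (htan Q (aux_mem_a K hQa ?_ ?_) hQL)
    · intro h
      exact hL (aux_line_unique hQP hQL hPL h hPb)
    · intro h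
      exact hBL (aux_pt_unique (aux_ac K) hQa K.hPB.1 h K.hPB.2 ▸ hQL)

theorem aux_a [Fintype F] (hq : 5 ≤ Fintype.card F)
    (hmin : IsMinimalBlocking K.pts) {P : Pt F} (hP : P ∈ K.pts) (hPa : Incid P K.a)
    (hno : ∀ (i j : Fin n) (m : Ln F), K.Bp i ≠ K.Cp j →
        Incid (K.Bp i) m → Incid (K.Cp j) m → ¬ Incid P m) :
    HasRInftyAt K.pts P := by
  obtain ⟨hPb, hPc⟩ := aux_of_mem_a K hP hPa
  refine aux_finish hmin hP (X := K.PA) (fun h => hPb (h ▸ K.hPA.1)) ?_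
  intro L hPL htan
  by_contra hAL
  by_cases hL : L = K.a
  · have hcard : (insert K.PC {P} : Set (Pt F)).ncard < Fintype.card F := by
      have h1 := Set.ncard_insert_le K.PC {P}
      rw [Set.ncard_singleton] at h1
      omega
    obtain ⟨Q, hQ, hQA, hQS⟩ := aux_count K.PB K.a K.hPB.1 _
      ((Set.finite_singleton P).insert _) hcard
    simp only [Set.mem_insert_iff, Set.mem_singleton_iff, not_or] at hQS
    refine hQS.2 (htan Q (aux_mem_a K hQ ?_ ?_) (hL ▸ hQ))
    · intro h
      exact hQS.1 (aux_pt_unique (aux_ab K) hQ K.hPC.1 h K.hPC.2)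
    · intro h
      exact hQA (aux_pt_unique (aux_ac K) hQ K.hPB.1 h K.hPB.2)
  · have key : ∀ K' : KConstruction F n, K'.pts = K.pts → K'.a = K.a → K'.PA = K.PA →
        ¬ Incid P K'.b → ∃ i, Incid (K'.Bp i) L := by
      intro K' hpts ha hA hPb'
      obtain ⟨Q, hQL, hQb⟩ := aux_meet L K'.b
      have hQP : Q ≠ P := fun h => hPb' (h ▸ hQb)
      by_contra hcon
      refine hQP (htan Q (hpts ▸ aux_mem_b K' hQb ?_ ?_ ?_) hQL)
      · intro h
        exact hL (aux_line_unique hQP hQL hPL (ha ▸ h) hPa)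
      · intro h
        have := aux_pt_unique (aux_bc K') hQb K'.hPA.1 h K'.hPA.2
        exact hAL (hA ▸ this ▸ hQL)
      · rintro ⟨i, rfl⟩
        exact hcon ⟨i, hQL⟩
    obtain ⟨i, hi⟩ := key K rfl rfl rfl hPb
    obtain ⟨j, hj⟩ := key K.swap (aux_swap_pts K) rfl rfl hPc
    refine hno i j L ?_ hi hj hPL
    intro h
    exact aux_Bp_c K i (h ▸ (K.hCp j).1)

end

/-- A minimal blocking set built with a `k`-construction, `2q ≤ k ≤ 3q-5`, has the
r∞-property with respect to every of its points on `b` or on `c`, and with respect to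
every of its points on `a` lying on no line `B_i C_j`. -/
theorem kConstruction_rInfty_at_points
    (F : Type) [Field F] [Fintype F] (hq : 5 ≤ Fintype.card F)
    (n : ℕ) (hn1 : 2 ≤ n) (hn2 : n ≤ Fintype.card F - 3)
    (K : KConstruction F n) (hmin : IsMinimalBlocking K.pts) :
    (∀ P ∈ K.pts, (Incid P K.b ∨ Incid P K.c) → HasRInftyAt K.pts P) ∧
    ∀ P ∈ K.pts, Incid P K.a →
      (∀ (i j : Fin n) (m : Ln F), K.Bp i ≠ K.Cp j →
        Incid (K.Bp i) m → Incid (K.Cp j) m → ¬ Incid P m) →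
      HasRInftyAt K.pts P := by
  refine ⟨fun P hP h => ?_, fun P hP h hno => aux_a K hq hmin hP h hno⟩
  rcases h with h | h
  · exact aux_b K hq hn2 hmin hP h
  · have := aux_b K.swap hq hn2 (by rw [aux_swap_pts]; exact hmin)
      (P := P) (by rw [aux_swap_pts]; exact hP) h
    rwa [aux_swap_pts] at this
end

section
/- For every prime power q ≥ 5 and every integer k with 2q ≤ k ≤ 3(q−1), there exists a minimal blocking set of PG(2,q) of size k which has the r∞-property with respect to some point of it. -/
variable {F : Type} [Field F]

lemma exists_g (F : Type) [Field F] [Fintype F] (hq : 5 ≤ Fintype.card F)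
    (m : ℕ) (h1 : 1 ≤ m) (h2 : m ≤ Fintype.card F - 2) :
    ∃ g : F → F, (g '' {0}ᶜ).ncard = m ∧
      ∀ b : F, b ≠ 0 → ∃ v ∈ g '' {0}ᶜ, ∀ t : F, t ≠ 0 → g t ≠ b * t + v := by
  classical
  rcases (by omega : m = 1 ∨ m = 2 ∨ 3 ≤ m) with rfl | rfl | h3
  · have : (fun _ : F => (0 : F)) '' {0}ᶜ = {0} := by
      ext x
      simp only [Set.mem_image, Set.mem_compl_iff, Set.mem_singleton_iff]
      constructor
      · rintro ⟨_, _, h⟩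
        exact h.symm
      · rintro rfl
        exact ⟨1, one_ne_zero, rfl⟩
    refine ⟨fun _ => 0, ?_, ?_⟩
    · rw [this]; simp
    · intro b hb
      rw [this]
      refine ⟨0, rfl, fun t ht h => ?_⟩
      have : b * t = 0 := by simpa using h.symm
      exact mul_ne_zero hb ht this
  · obtain ⟨w, hw⟩ : ∃ w : F, w ∉ ({0, 1, -1} : Finset F) := by
      by_contra! hcon
      have := Finset.card_le_card (fun x _ => hcon x : (Finset.univ : Finset F) ⊆ _)
      rw [Finset.card_univ] at this
      have h3 := Finset.card_le_three (a := (0 : F)) (b := 1) (c := -1)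
      omega
    simp only [Finset.mem_insert, Finset.mem_singleton, not_or] at hw
    obtain ⟨w0, w1, w2⟩ := hw
    have : (fun t : F => if t = 1 ∨ t = -1 then (1 : F) else 0) '' {0}ᶜ = {0, 1} := by
      ext x
      simp only [Set.mem_image, Set.mem_compl_iff, Set.mem_singleton_iff, Set.mem_insert_iff]
      constructor
      · rintro ⟨t, _, h⟩
        split_ifs at h
        · exact Or.inr h.symm
        · exact Or.inl h.symm
      · rintro (rfl | rfl)
        · exact ⟨w, w0, by simp [w1, w2]⟩
        · exact ⟨1, one_ne_zero, by simp⟩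
    refine ⟨fun t => if t = 1 ∨ t = -1 then 1 else 0, ?_, ?_⟩
    · rw [this]; exact Set.ncard_pair zero_ne_one
    · intro b hb
      rw [this]
      by_cases hb1 : b = 1 ∨ b = -1
      · refine ⟨1, by simp, fun t ht h => ?_⟩
        dsimp only at h
        split_ifs at h with h'
        · have : b * t = 0 := by linear_combination -h
          exact mul_ne_zero hb ht this
        · apply h'
          rcases hb1 with rfl | rfl
          · right; linear_combination -h
          · left; linear_combination h
      · refine ⟨0, by simp, fun t ht h => ?_⟩
        dsimp only at h
        split_ifs at h with h'
        · apply hb1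
          rcases h' with rfl | rfl
          · left; linear_combination -h
          · right; linear_combination h
        · have : b * t = 0 := by linear_combination -h
          exact mul_ne_zero hb ht this
  · obtain ⟨S, hS1, hS2, hS3⟩ := Finset.exists_subsuperset_card_eq
      (s := ({1, -1} : Finset F)) (t := Finset.univ.erase 0) (n := m - 1)
      (by intro x; simp only [Finset.mem_insert, Finset.mem_singleton, Finset.mem_erase]
          rintro (rfl | rfl) <;> simp)
      (by have := Finset.card_le_two (a := (1 : F)) (b := -1); omega)
      (by rw [Finset.card_erase_of_mem (Finset.mem_univ _), Finset.card_univ]; omega)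
    have hS0 : (0 : F) ∉ S := fun h => by simpa using hS2 h
    obtain ⟨w, hw⟩ : ∃ w : F, w ∉ insert 0 S := by
      by_contra! hcon
      have := Finset.card_le_card (fun x _ => hcon x : (Finset.univ : Finset F) ⊆ _)
      rw [Finset.card_univ, Finset.card_insert_of_notMem hS0] at this
      omega
    simp only [Finset.mem_insert, not_or] at hw
    have hi : (fun t : F => if t ∈ S then t else 0) '' {0}ᶜ = (insert 0 S : Finset F) := by
      ext x
      simp only [Set.mem_image, Set.mem_compl_iff, Set.mem_singleton_iff, Finset.coe_insert,
        Set.mem_insert_iff, Finset.mem_coe]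
      constructor
      · rintro ⟨t, _, h⟩
        split_ifs at h with h'
        · exact Or.inr (h ▸ h')
        · exact Or.inl h.symm
      · rintro (rfl | h)
        · exact ⟨w, hw.1, by simp [hw.2]⟩
        · exact ⟨x, fun h' => hS0 (h' ▸ h), by simp [h]⟩
    refine ⟨fun t => if t ∈ S then t else 0, ?_, ?_⟩
    · rw [hi, Set.ncard_coe_finset, Finset.card_insert_of_notMem hS0]; omega
    · intro b hb
      rw [hi]
      by_cases hb1 : b = 1
      · subst hb1
        refine ⟨1, by simpa using hS1 (Finset.mem_insert_self 1 {-1}), fun t ht h => ?_⟩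
        dsimp only at h
        split_ifs at h with h'
        · exact one_ne_zero (α := F) (by linear_combination -h)
        · apply h'
          have : t = -1 := by linear_combination -h
          rw [this]; exact hS1 (by simp)
      · refine ⟨0, by simp, fun t ht h => ?_⟩
        dsimp only at h
        split_ifs at h with h'
        · have : (b - 1) * t = 0 := by linear_combination -h
          rcases mul_eq_zero.1 this with h | h
          · exact hb1 (by linear_combination h)
          · exact ht h
        · have : b * t = 0 := by linear_combination -h
          exact mul_ne_zero hb ht this

lemma exists_functional (L : Ln F) : ∃ a b c : F, (a ≠ 0 ∨ b ≠ 0 ∨ c ≠ 0) ∧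
    ∀ v : Fin 3 → F, v ∈ L.1 ↔ a * v 0 + b * v 1 + c * v 2 = 0 := by
  have hlt : L.1 < ⊤ := by
    rw [lt_top_iff_ne_top]
    intro h
    have h2 := L.2
    rw [h, finrank_top] at h2
    simp at h2
  obtain ⟨f, hf, hle⟩ := Submodule.exists_le_ker_of_lt_top L.1 hlt
  have hrk : Module.finrank F (LinearMap.ker f) = 2 := by
    have := Module.Dual.finrank_ker_add_one_of_ne_zero hf
    simp at this
    omega
  have heq : L.1 = LinearMap.ker f :=
    Submodule.eq_of_le_of_finrank_eq hle (by rw [L.2, hrk])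
  have hfv : ∀ v, f v = f (Pi.single 0 1) * v 0 + f (Pi.single 1 1) * v 1
      + f (Pi.single 2 1) * v 2 := by
    intro v
    conv_lhs => rw [LinearMap.pi_apply_eq_sum_univ f v]
    have e : ∀ i : Fin 3, (fun j => if i = j then (1 : F) else 0) = Pi.single i 1 := by
      intro i
      ext j
      simp [Pi.single_apply, eq_comm]
    simp only [e, Fin.sum_univ_three, smul_eq_mul]
    ring
  refine ⟨f (Pi.single 0 1), f (Pi.single 1 1), f (Pi.single 2 1), ?_, ?_⟩
  · by_contra! h
    apply hf
    refine LinearMap.ext fun v => ?_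
    rw [hfv, h.1, h.2.1, h.2.2]
    simp
  · intro v
    rw [heq, LinearMap.mem_ker, hfv]

lemma exists_line (a b c : F) (h : a ≠ 0 ∨ b ≠ 0 ∨ c ≠ 0) : ∃ L : Ln F,
    ∀ v : Fin 3 → F, v ∈ L.1 ↔ a * v 0 + b * v 1 + c * v 2 = 0 := by
  let f : (Fin 3 → F) →ₗ[F] F :=
    a • LinearMap.proj 0 + b • LinearMap.proj 1 + c • LinearMap.proj 2
  have hfv : ∀ v, f v = a * v 0 + b * v 1 + c * v 2 := fun v => by simp [f]
  have hf : f ≠ 0 := by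
    rintro h0
    have e0 := hfv (Pi.single 0 1)
    have e1 := hfv (Pi.single 1 1)
    have e2 := hfv (Pi.single 2 1)
    rw [h0] at e0 e1 e2
    simp at e0 e1 e2
    simp_all
  refine ⟨⟨LinearMap.ker f, ?_⟩, fun v => ?_⟩
  · have := Module.Dual.finrank_ker_add_one_of_ne_zero (f := f) hf
    simp at this
    omega
  · rw [LinearMap.mem_ker, hfv]

lemma line_cases (L : Ln F) :
    (∀ v : Fin 3 → F, v ∈ L.1 ↔ v 2 = 0) ∨
    (∃ t : F, ∀ v : Fin 3 → F, v ∈ L.1 ↔ v 0 = t * v 2) ∨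
    (∃ b c : F, ∀ v : Fin 3 → F, v ∈ L.1 ↔ v 1 = b * v 0 + c * v 2) := by
  obtain ⟨a, b, c, h, hL⟩ := exists_functional L
  by_cases hb : b = 0
  · subst hb
    by_cases ha : a = 0
    · subst ha
      have hc : c ≠ 0 := by simpa using h
      left
      intro v
      rw [hL]
      simp [hc]
    · right; left
      refine ⟨-c / a, fun v => ?_⟩
      rw [hL]
      field_simp
      constructor <;> intro h <;> linear_combination h
  · right; right
    refine ⟨-a / b, -c / b, fun v => ?_⟩
    rw [hL]
    field_simp
    constructor <;> intro h <;> linear_combination h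

lemma line_ext {L M : Ln F} (h : ∀ v, v ∈ L.1 ↔ v ∈ M.1) : L = M :=
  Subtype.ext (Submodule.ext h)

lemma aff_ne (x y : F) : (![x, y, 1] : Fin 3 → F) ≠ 0 := fun h => by
  simpa using congrFun h 2

lemma ifp_ne (b : F) : (![1, b, 0] : Fin 3 → F) ≠ 0 := fun h => by
  simpa using congrFun h 0

lemma vert_ne : (![0, 1, 0] : Fin 3 → F) ≠ 0 := fun h => by
  simpa using congrFun h 1

def mkPt (v : Fin 3 → F) (hv : v ≠ 0) : Pt F := ⟨F ∙ v, finrank_span_singleton hv⟩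

lemma incid_mkPt (v : Fin 3 → F) (hv : v ≠ 0) (L : Ln F) : Incid (mkPt v hv) L ↔ v ∈ L.1 := by
  simp [Incid, mkPt]

lemma mkPt_eq {v w : Fin 3 → F} {hv : v ≠ 0} {hw : w ≠ 0} (h : mkPt v hv = mkPt w hw) :
    ∃ a : F, a • w = v := by
  have h' : F ∙ v = F ∙ w := congrArg Subtype.val h
  have : v ∈ F ∙ w := h' ▸ Submodule.mem_span_singleton_self v
  exact Submodule.mem_span_singleton.1 this

def aff (x y : F) : Pt F := mkPt ![x, y, 1] (aff_ne x y)
def ifp (b : F) : Pt F := mkPt ![1, b, 0] (ifp_ne b)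
def vrt : Pt F := mkPt ![0, 1, 0] vert_ne

lemma aff_inj {x y x' y' : F} (h : aff x y = aff x' y') : x = x' ∧ y = y' := by
  obtain ⟨a, ha⟩ := mkPt_eq h
  have h0 := congrFun ha 0
  have h1 := congrFun ha 1
  have h2 := congrFun ha 2
  simp at h0 h1 h2
  subst h2
  simp at h0 h1
  exact ⟨h0.symm, h1.symm⟩

lemma ifp_inj {b c : F} (h : ifp b = ifp c) : b = c := by
  obtain ⟨a, ha⟩ := mkPt_eq h
  have h0 := congrFun ha 0
  have h1 := congrFun ha 1
  simp at h0 h1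
  subst h0
  simpa using h1.symm

lemma aff_ne_ifp {x y b : F} : aff x y ≠ ifp b := fun h => by
  obtain ⟨a, ha⟩ := mkPt_eq h
  simpa using congrFun ha 2

lemma aff_ne_vrt {x y : F} : aff x y ≠ vrt := fun h => by
  obtain ⟨a, ha⟩ := mkPt_eq h
  simpa using congrFun ha 2

lemma ifp_ne_vrt {b : F} : ifp b ≠ vrt := fun h => by
  obtain ⟨a, ha⟩ := mkPt_eq h
  simpa using congrFun ha 0

lemma incid_aff (x y : F) (L : Ln F) : Incid (aff x y) L ↔ ![x, y, 1] ∈ L.1 := incid_mkPt _ _ _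
lemma incid_ifp (b : F) (L : Ln F) : Incid (ifp b) L ↔ ![1, b, 0] ∈ L.1 := incid_mkPt _ _ _
lemma incid_vrt (L : Ln F) : Incid vrt L ↔ ![0, 1, 0] ∈ L.1 := incid_mkPt _ _ _

/-- The blocking set built from `g`. -/
def BG (g : F → F) : Set (Pt F) :=
  {P | (∃ u, u ∉ g '' {0}ᶜ ∧ P = aff 0 u) ∨ (∃ b, b ≠ 0 ∧ P = ifp b) ∨
    (∃ t, t ≠ 0 ∧ P = aff t (g t))}

lemma BG_ncard [Fintype F] (g : F → F) (m : ℕ) (hm : (g '' {0}ᶜ).ncard = m) :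
    (BG g).ncard + m + 2 = 3 * Fintype.card F := by
  have hB : BG g = (((fun u => aff 0 u) '' (g '' {0}ᶜ)ᶜ) ∪ (ifp '' {0}ᶜ)) ∪
      ((fun t => aff t (g t)) '' {0}ᶜ) := by
    ext P
    simp only [BG, Set.mem_ofPred_eq, Set.mem_union, Set.mem_image (f := fun u : F => aff 0 u),
      Set.mem_image (f := ifp), Set.mem_image (f := fun t => aff t (g t)), Set.mem_compl_iff,
      Set.mem_singleton_iff, or_assoc, eq_comm (a := P)]
  have d1 : Disjoint ((fun u => aff (0 : F) u) '' (g '' {0}ᶜ)ᶜ) (ifp '' {0}ᶜ) := by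
    rw [Set.disjoint_left]
    rintro _ ⟨u, _, rfl⟩ ⟨b, _, h⟩
    exact aff_ne_ifp h.symm
  have d2 : Disjoint (((fun u => aff (0 : F) u) '' (g '' {0}ᶜ)ᶜ) ∪ (ifp '' {0}ᶜ))
      ((fun t => aff t (g t)) '' {0}ᶜ) := by
    rw [Set.disjoint_left]
    rintro _ (⟨u, _, rfl⟩ | ⟨b, _, rfl⟩) ⟨t, ht, h⟩
    · exact ht (aff_inj h).1
    · exact aff_ne_ifp h
  have c0 : ({0}ᶜ : Set F).ncard + 1 = Fintype.card F := by
    have := Set.ncard_add_ncard_compl ({0} : Set F)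
    rw [Set.ncard_singleton, Nat.card_eq_fintype_card] at this
    omega
  have c1 := Set.ncard_add_ncard_compl (g '' {0}ᶜ)
  rw [hm, Nat.card_eq_fintype_card] at c1
  rw [hB, Set.ncard_union_eq d2 (Set.toFinite _) (Set.toFinite _),
    Set.ncard_union_eq d1 (Set.toFinite _) (Set.toFinite _),
    Set.ncard_image_of_injective _ (fun x y h => (aff_inj h).2),
    Set.ncard_image_of_injective _ (fun x y h => ifp_inj h),
    Set.ncard_image_of_injective _ (fun x y h => (aff_inj h).1)]
  omega

lemma minimal_of_tangents {B : Set (Pt F)} (hB : IsBlocking B)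
    (h : ∀ P ∈ B, ∃ L : Ln F, ∀ Q ∈ B, Incid Q L → Q = P) : IsMinimalBlocking B := by
  refine ⟨hB, fun B' hss hB' => ?_⟩
  obtain ⟨P, hP, hP'⟩ := Set.exists_of_ssubset hss
  obtain ⟨L, hL⟩ := h P hP
  obtain ⟨Q, hQ, hQL⟩ := hB'.1 L
  exact hP' (hL Q (hss.1 hQ) hQL ▸ hQ)

lemma exists_line_vert (t : F) : ∃ L : Ln F, ∀ v : Fin 3 → F, v ∈ L.1 ↔ v 0 = t * v 2 := by
  obtain ⟨L, hL⟩ := exists_line (1 : F) 0 (-t) (by simp)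
  refine ⟨L, fun v => ?_⟩
  rw [hL]
  constructor <;> intro h <;> linear_combination h

lemma exists_line_slope (b c : F) :
    ∃ L : Ln F, ∀ v : Fin 3 → F, v ∈ L.1 ↔ v 1 = b * v 0 + c * v 2 := by
  obtain ⟨L, hL⟩ := exists_line (-b) (1 : F) (-c) (by simp)
  refine ⟨L, fun v => ?_⟩
  rw [hL]
  constructor <;> intro h <;> linear_combination h

lemma vert_tangent (g : F → F) (t : F) (ht : t ≠ 0) (L : Ln F)
    (hL : ∀ v : Fin 3 → F, v ∈ L.1 ↔ v 0 = t * v 2) :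
    ∀ Q ∈ BG g, Incid Q L → Q = aff t (g t) := by
  rintro Q (⟨u, hu, rfl⟩ | ⟨b, hb, rfl⟩ | ⟨s, hs, rfl⟩) hQ
  · rw [incid_aff, hL] at hQ
    exact absurd (by simpa using hQ.symm) ht
  · rw [incid_ifp, hL] at hQ
    simp at hQ
  · rw [incid_aff, hL] at hQ
    have : s = t := by simpa using hQ
    rw [this]

/-- For every prime power `q ≥ 5` and every `2q ≤ k ≤ 3(q-1)` there is a minimal
blocking set of PG(2,q) of size `k` having the r∞-property with respect to some of its
points. -/
theorem exists_minimalBlocking_rInfty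
    (F : Type) [Field F] [Fintype F] (hq : 5 ≤ Fintype.card F)
    (k : ℕ) (hk1 : 2 * Fintype.card F ≤ k) (hk2 : k ≤ 3 * (Fintype.card F - 1)) :
    ∃ B : Set (Pt F), IsMinimalBlocking B ∧ B.ncard = k ∧
      ∃ P ∈ B, HasRInftyAt B P := by
  classical
  obtain ⟨g, hm, hg⟩ := exists_g F hq (3 * Fintype.card F - 2 - k) (by omega) (by omega)
  have hcard := BG_ncard g _ hm
  have c0 : ({0}ᶜ : Set F).ncard + 1 = Fintype.card F := by
    have := Set.ncard_add_ncard_compl ({0} : Set F)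
    rw [Set.ncard_singleton, Nat.card_eq_fintype_card] at this
    omega
  obtain ⟨t₁, ht₁, t₂, ht₂, hne, hgt⟩ := Set.exists_ne_map_eq_of_ncard_lt_of_maps_to
    (s := ({0}ᶜ : Set F)) (t := g '' {0}ᶜ) (by omega) (f := g)
    (fun a ha => Set.mem_image_of_mem g ha)
  have ht₁ : t₁ ≠ 0 := ht₁
  have ht₂ : t₂ ≠ 0 := ht₂
  obtain ⟨u₀, hu₀⟩ : ∃ u, u ∉ g '' {0}ᶜ := by
    by_contra! hcon
    have hu : g '' {0}ᶜ = Set.univ := Set.eq_univ_of_forall hcon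
    rw [hu, Set.ncard_univ, Nat.card_eq_fintype_card] at hm
    omega
  have mU : ∀ u, u ∉ g '' {0}ᶜ → aff 0 u ∈ BG g := fun u hu => Or.inl ⟨u, hu, rfl⟩
  have mI : ∀ b, b ≠ 0 → ifp b ∈ BG g := fun b hb => Or.inr (Or.inl ⟨b, hb, rfl⟩)
  have mR : ∀ t, t ≠ 0 → aff t (g t) ∈ BG g := fun t ht => Or.inr (Or.inr ⟨t, ht, rfl⟩)
  have nV : vrt ∉ BG g := by
    rintro (⟨u, _, h⟩ | ⟨b, _, h⟩ | ⟨s, _, h⟩)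
    · exact aff_ne_vrt h.symm
    · exact ifp_ne_vrt h.symm
    · exact aff_ne_vrt h.symm
  have nI : ifp (0 : F) ∉ BG g := by
    rintro (⟨u, _, h⟩ | ⟨b, hb, h⟩ | ⟨s, _, h⟩)
    · exact aff_ne_ifp h.symm
    · exact hb (ifp_inj h).symm
    · exact aff_ne_ifp h.symm
  have nR : ∀ t u, t ≠ 0 → u ≠ g t → aff t u ∉ BG g := by
    rintro t u ht hu (⟨u, _, h⟩ | ⟨b, hb, h⟩ | ⟨s, _, h⟩)
    · exact ht (aff_inj h).1
    · exact aff_ne_ifp h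
    · obtain ⟨rfl, h2⟩ := aff_inj h
      exact hu h2
  have hblock : IsBlocking (BG g) := by
    constructor
    · intro L
      rcases line_cases L with hL | ⟨t, hL⟩ | ⟨b, c, hL⟩
      · exact ⟨_, mI 1 one_ne_zero, by rw [incid_ifp, hL]; simp⟩
      · by_cases ht : t = 0
        · exact ⟨_, mU u₀ hu₀, by rw [incid_aff, hL]; simp [ht]⟩
        · exact ⟨_, mR t ht, by rw [incid_aff, hL]; simp⟩
      · by_cases hb : b = 0
        · by_cases hc : c ∈ g '' {0}ᶜ
          · obtain ⟨t, ht, rfl⟩ := hc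
            exact ⟨_, mR t ht, by rw [incid_aff, hL]; simp [hb]⟩
          · exact ⟨_, mU c hc, by rw [incid_aff, hL]; simp⟩
        · exact ⟨_, mI b hb, by rw [incid_ifp, hL]; simp⟩
    · intro L
      rcases line_cases L with hL | ⟨t, hL⟩ | ⟨b, c, hL⟩
      · exact ⟨_, by rw [incid_vrt, hL]; simp, nV⟩
      · exact ⟨_, by rw [incid_vrt, hL]; simp, nV⟩
      · by_cases hb : b = 0
        · exact ⟨_, by rw [incid_ifp, hL]; simp [hb], nI⟩
        · by_cases h1 : b * t₁ + c = g t₁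
          · refine ⟨aff t₂ (b * t₂ + c), by rw [incid_aff, hL]; simp, nR _ _ ht₂ fun h2 => hne ?_⟩
            apply mul_left_cancel₀ hb
            linear_combination h1 - h2 + hgt
          · exact ⟨aff t₁ (b * t₁ + c), by rw [incid_aff, hL]; simp, nR _ _ ht₁ h1⟩
  refine ⟨BG g, minimal_of_tangents hblock ?_, by omega, aff t₁ (g t₁), mR _ ht₁, ?_⟩
  · rintro P (⟨u, hu, rfl⟩ | ⟨b, hb, rfl⟩ | ⟨t, ht, rfl⟩)
    · obtain ⟨L, hL⟩ := exists_line_slope 0 u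
      refine ⟨L, ?_⟩
      rintro Q (⟨u', hu', rfl⟩ | ⟨b, hb, rfl⟩ | ⟨s, hs, rfl⟩) hQ
      · rw [incid_aff, hL] at hQ
        have : u' = u := by simpa using hQ
        rw [this]
      · rw [incid_ifp, hL] at hQ
        exact absurd (by simpa using hQ) hb
      · rw [incid_aff, hL] at hQ
        have : g s = u := by simpa using hQ
        exact absurd ⟨s, hs, this⟩ hu
    · obtain ⟨v, hv, hvt⟩ := hg b hb
      obtain ⟨L, hL⟩ := exists_line_slope b v
      refine ⟨L, ?_⟩
      rintro Q (⟨u', hu', rfl⟩ | ⟨b', hb', rfl⟩ | ⟨s, hs, rfl⟩) hQ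
      · rw [incid_aff, hL] at hQ
        have : u' = v := by simpa using hQ
        exact absurd (this ▸ hv) hu'
      · rw [incid_ifp, hL] at hQ
        have : b' = b := by simpa using hQ
        rw [this]
      · rw [incid_aff, hL] at hQ
        exact absurd (by simpa using hQ) (hvt s hs)
    · obtain ⟨L, hL⟩ := exists_line_vert t
      exact ⟨L, vert_tangent g t ht L hL⟩
  · obtain ⟨r, hr⟩ := exists_line_vert t₁
    have hinc : Incid (aff t₁ (g t₁)) r := by rw [incid_aff, hr]; simp
    refine ⟨r, hinc, ⟨_, ⟨mR _ ht₁, hinc⟩, fun Q hQ => vert_tangent g t₁ ht₁ r hr Q hQ.1 hQ.2⟩, ?_⟩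
    intro L hPL hLr
    have hPL' := hPL
    rw [incid_aff] at hPL'
    rcases line_cases L with hL | ⟨t, hL⟩ | ⟨b, c, hL⟩
    · rw [hL] at hPL'
      simp at hPL'
    · rw [hL] at hPL'
      have : t₁ = t := by simpa using hPL'
      subst this
      exact absurd (line_ext fun v => by rw [hL, hr]) hLr
    · rw [hL] at hPL'
      have hPL' : g t₁ = b * t₁ + c := by simpa using hPL'
      by_cases hb : b = 0
      · refine ⟨_, _, fun h => hne (aff_inj h).1, mR _ ht₁, mR _ ht₂, hPL, ?_⟩
        rw [incid_aff, hL]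
        subst hb
        simp only [Matrix.cons_val]
        linear_combination hPL' - hgt
      · exact ⟨_, _, aff_ne_ifp, mR _ ht₁, mI b hb, hPL, by rw [incid_ifp, hL]; simp⟩
end
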